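/- There exist absolute constants ε₀ > 0 and C > 0 such that for every (1+ε)-quasigeodesic γ : ℝ → ℍ with 0 < ε ≤ ε₀ and every nondegenerate bounded interval I ⊂ ℝ, the horizontal speed γ̇_H satisfies 1 − C√ε ≤ |(1/|I|) ∫_I γ̇_H(s) ds| ≤ 1 + ε. -/

import Mathlib

noncomputable section

open MeasureTheory

/-- Points of the Heisenberg group `ℍ`, identified with `ℝ³ ≅ ℂ × ℝ`:
`(x, y, t)` corresponds to `(z ; t)` with `z = x + iy`. -/
abbrev H : Type := ℝ × ℝ × ℝ

/-- The Heisenberg group law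
`(x,y,t)·(x',y',t') = (x+x', y+y', t+t'+2(x'y − xy'))`. -/
def Hmul (p q : H) : H :=
  (p.1 + q.1, p.2.1 + q.2.1, p.2.2 + q.2.2 + 2 * (q.1 * p.2.1 - p.1 * q.2.1))

/-- The Heisenberg group inverse. -/
def Hinv (p : H) : H := (-p.1, -p.2.1, -p.2.2)

/-- The identity `O = (0,0,0)`. -/
def HO : H := (0, 0, 0)

/-- The control (Carnot–Carathéodory) distance: the infimum of the lengths
`∫₀¹ √(a(s)² + b(s)²) ds` of horizontal Lipschitz curves `γ` joining `P` to `Q`,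
i.e. curves satisfying a.e. `γ' = a·X(γ) + b·Y(γ)` where `X = ∂ₓ + 2y∂_t` and
`Y = ∂_y − 2x∂_t`. -/
def dH (P Q : H) : ℝ :=
  sInf { L : ℝ | ∃ (γ : ℝ → H) (a b : ℝ → ℝ) (K : NNReal),
    LipschitzWith K γ ∧ γ 0 = P ∧ γ 1 = Q ∧
    (∀ᵐ s ∂volume, s ∈ Set.Icc (0:ℝ) 1 →
      HasDerivAt γ (a s, b s, 2 * (γ s).2.1 * a s - 2 * (γ s).1 * b s) s) ∧
    IntervalIntegrable (fun s => Real.sqrt (a s ^ 2 + b s ^ 2)) volume 0 1 ∧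
    L = ∫ s in (0:ℝ)..1, Real.sqrt (a s ^ 2 + b s ^ 2) }

/-- `γ : ℝ → ℍ` is a `(1+ε)`-quasigeodesic. -/
def IsQuasiGeodesic (ε : ℝ) (γ : ℝ → H) : Prop :=
  ∀ s s' : ℝ, (1 + ε)⁻¹ * |s - s'| ≤ dH (γ s) (γ s') ∧
    dH (γ s) (γ s') ≤ (1 + ε) * |s - s'|

/-- `f : ℍ → ℍ` is `(1+ε)`-biLipschitz for the control distance. -/
def IsBiLip (ε : ℝ) (f : H → H) : Prop :=
  ∀ P Q : H, (1 + ε)⁻¹ * dH P Q ≤ dH (f P) (f Q) ∧ dH (f P) (f Q) ≤ (1 + ε) * dH P Q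

/-- `(a,b)` is the horizontal speed of `γ`: a.e. `γ'(s) = a(s)X(γ(s)) + b(s)Y(γ(s))`. -/
def HasHorizSpeed (γ : ℝ → H) (a b : ℝ → ℝ) : Prop :=
  ∀ᵐ s ∂volume, HasDerivAt γ (a s, b s, 2 * (γ s).2.1 * a s - 2 * (γ s).1 * b s) s

/-- `L` is the length of a horizontal curve joining `P` to `Q`. -/
def Reach (P Q : H) (L : ℝ) : Prop := ∃ (γ : ℝ → H) (a b : ℝ → ℝ) (K : NNReal),
    LipschitzWith K γ ∧ γ 0 = P ∧ γ 1 = Q ∧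
    (∀ᵐ s ∂volume, s ∈ Set.Icc (0:ℝ) 1 →
      HasDerivAt γ (a s, b s, 2 * (γ s).2.1 * a s - 2 * (γ s).1 * b s) s) ∧
    IntervalIntegrable (fun s => Real.sqrt (a s ^ 2 + b s ^ 2)) volume 0 1 ∧
    L = ∫ s in (0:ℝ)..1, Real.sqrt (a s ^ 2 + b s ^ 2)

lemma dH_eq (P Q : H) : dH P Q = sInf {L | Reach P Q L} := rfl

lemma Reach.nonneg {P Q : H} {L : ℝ} (h : Reach P Q L) : 0 ≤ L := by
  obtain ⟨γ, a, b, K, -, -, -, -, -, rfl⟩ := h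
  exact intervalIntegral.integral_nonneg zero_le_one (fun u _ => Real.sqrt_nonneg _)

lemma Reach.dH_le {P Q : H} {L : ℝ} (h : Reach P Q L) : dH P Q ≤ L :=
  csInf_le ⟨0, fun _ hl => Reach.nonneg hl⟩ h

lemma hd1 {γ : ℝ → H} {v : H} {s : ℝ} (h : HasDerivAt γ v s) :
    HasDerivAt (fun s => (γ s).1) v.1 s :=
  (ContinuousLinearMap.fst ℝ ℝ (ℝ × ℝ)).hasFDerivAt.comp_hasDerivAt s h

lemma hd2 {γ : ℝ → H} {v : H} {s : ℝ} (h : HasDerivAt γ v s) :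
    HasDerivAt (fun s => (γ s).2.1) v.2.1 s :=
  ((ContinuousLinearMap.fst ℝ ℝ ℝ).comp
    (ContinuousLinearMap.snd ℝ ℝ (ℝ × ℝ))).hasFDerivAt.comp_hasDerivAt s h

lemma hd3 {γ : ℝ → H} {v : H} {s : ℝ} (h : HasDerivAt γ v s) :
    HasDerivAt (fun s => (γ s).2.2) v.2.2 s :=
  ((ContinuousLinearMap.snd ℝ ℝ ℝ).comp
    (ContinuousLinearMap.snd ℝ ℝ (ℝ × ℝ))).hasFDerivAt.comp_hasDerivAt s h

lemma Reach.seg (x y : ℝ) : Reach HO (x, y, 0) (Real.sqrt (x ^ 2 + y ^ 2)) := by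
  let f : ℝ →L[ℝ] H := (ContinuousLinearMap.id ℝ ℝ).smulRight ((x, y, 0) : H)
  have hf : ∀ s, f s = (s * x, s * y, 0) := by intro s; simp [f]
  refine ⟨f, fun _ => x, fun _ => y, _, f.lipschitz, ?_, ?_, ?_, ?_, ?_⟩
  · simp [hf, HO]
  · simp [hf]
  · refine Filter.Eventually.of_forall fun s _ => ?_
    refine (f.hasDerivAt (x := s)).congr_deriv ?_
    rw [hf, hf]
    ext <;> simp <;> ring
  · exact intervalIntegrable_const
  · simp

/-- linear part of left translation -/
def lmulLin (g : H) : H →ₗ[ℝ] H where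
  toFun p := (p.1, p.2.1, p.2.2 + 2 * (p.1 * g.2.1 - g.1 * p.2.1))
  map_add' p q := by ext <;> simp <;> ring
  map_smul' c p := by ext <;> simp <;> ring

/-- dilation -/
def dilLin (r : ℝ) : H →ₗ[ℝ] H where
  toFun p := (r * p.1, r * p.2.1, r ^ 2 * p.2.2)
  map_add' p q := by ext <;> simp <;> ring
  map_smul' c p := by ext <;> simp <;> ring

lemma Reach.lmul (g : H) {P Q : H} {L : ℝ} (h : Reach P Q L) :
    Reach (Hmul g P) (Hmul g Q) L := by
  obtain ⟨γ, a, b, K, hK, h0, h1, hd, hi, hL⟩ := h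
  have key : ∀ p, Hmul g p = g + (lmulLin g).toContinuousLinearMap p := by
    intro p; ext <;> simp [Hmul, lmulLin] <;> ring
  refine ⟨fun s => Hmul g (γ s), a, b, ‖(lmulLin g).toContinuousLinearMap‖₊ * K,
    ?_, by simp [h0], by simp [h1], ?_, hi, hL⟩
  · simp only [key]
    have := ((lmulLin g).toContinuousLinearMap.lipschitz.comp hK)
    exact LipschitzWith.of_dist_le_mul fun x y => by
      simpa using this.dist_le_mul x y
  · filter_upwards [hd] with s hs hs'
    have := ((lmulLin g).toContinuousLinearMap.hasFDerivAt.comp_hasDerivAt s (hs hs')).const_add g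
    have e : (fun s => Hmul g (γ s)) =
        fun s => g + ((lmulLin g).toContinuousLinearMap ∘ γ) s := by
      funext s; exact key _
    rw [e]
    refine this.congr_deriv ?_
    ext <;> simp [lmulLin, Hmul]
    ring

lemma Reach.dil {r : ℝ} (hr : 0 ≤ r) {P Q : H} {L : ℝ} (h : Reach P Q L) :
    Reach (dilLin r P) (dilLin r Q) (r * L) := by
  obtain ⟨γ, a, b, K, hK, h0, h1, hd, hi, hL⟩ := h
  have e : ∀ s, Real.sqrt ((r * a s) ^ 2 + (r * b s) ^ 2) = r * Real.sqrt (a s ^ 2 + b s ^ 2) := by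
    intro s
    rw [show (r * a s) ^ 2 + (r * b s) ^ 2 = r ^ 2 * (a s ^ 2 + b s ^ 2) by ring,
      Real.sqrt_mul (sq_nonneg r), Real.sqrt_sq hr]
  refine ⟨fun s => (dilLin r).toContinuousLinearMap (γ s), fun s => r * a s, fun s => r * b s, _,
    (dilLin r).toContinuousLinearMap.lipschitz.comp hK, by simp [h0], by simp [h1], ?_, ?_, ?_⟩
  · filter_upwards [hd] with s hs hs'
    have := ((dilLin r).toContinuousLinearMap.hasFDerivAt.comp_hasDerivAt s (hs hs'))
    refine this.congr_deriv ?_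
    ext <;> simp [dilLin]
    ring
  · simp only [e]; exact hi.const_mul r
  · simp only [e]; rw [intervalIntegral.integral_const_mul, hL]

lemma ae_affine {p : ℝ → Prop} (h : ∀ᵐ s ∂(volume : Measure ℝ), p s) (c : ℝ) :
    ∀ᵐ s ∂(volume : Measure ℝ), p (2 * s - c) := by
  have q1 : Measure.QuasiMeasurePreserving (fun s : ℝ => 2 * s) volume volume := by
    refine ⟨by fun_prop, ?_⟩
    rw [Real.map_volume_mul_left two_ne_zero]
    exact Measure.smul_absolutelyContinuous
  have q2 := (measurePreserving_sub_right (volume : Measure ℝ) c).quasiMeasurePreserving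
  exact q1.ae (q2.ae h)

lemma Reach.trans {P Q R : H} {L M : ℝ} (h : Reach P Q L) (h' : Reach Q R M) :
    Reach P R (L + M) := by
  obtain ⟨γ, a, b, K, hK, h0, h1, hd, hi, hL⟩ := h
  obtain ⟨δ, c, d, J, hJ, k0, k1, kd, ki, hM⟩ := h'
  let A : ℝ → ℝ := fun s => if s < 1/2 then 2 * a (2 * s) else 2 * c (2 * s - 1)
  let B : ℝ → ℝ := fun s => if s < 1/2 then 2 * b (2 * s) else 2 * d (2 * s - 1)
  let ψ : ℝ → H := fun s => γ (min (2 * s) 1) + δ (max (2 * s - 1) 0) - Q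
  have e : ∀ u v : ℝ, Real.sqrt ((2 * u) ^ 2 + (2 * v) ^ 2) = 2 * Real.sqrt (u ^ 2 + v ^ 2) := by
    intro u v
    rw [show (2 * u) ^ 2 + (2 * v) ^ 2 = 2 ^ 2 * (u ^ 2 + v ^ 2) by ring,
      Real.sqrt_mul (by norm_num), Real.sqrt_sq (by norm_num)]
  have i1 : IntervalIntegrable (fun s => 2 * Real.sqrt (a (2 * s) ^ 2 + b (2 * s) ^ 2))
      volume 0 (1/2) := by
    have := (hi.comp_mul_left (c := 2)).const_mul 2
    simpa using this
  have i2 : IntervalIntegrable (fun s => 2 * Real.sqrt (c (2 * s - 1) ^ 2 + d (2 * s - 1) ^ 2))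
      volume (1/2) 1 := by
    have := ((ki.comp_sub_right 1).comp_mul_left (c := 2)).const_mul 2
    norm_num at this
    simpa using this
  have c1 : Set.EqOn (fun s => 2 * Real.sqrt (a (2 * s) ^ 2 + b (2 * s) ^ 2))
      (fun s => Real.sqrt (A s ^ 2 + B s ^ 2)) (Set.uIoo 0 (1/2)) := by
    intro s hs
    rw [Set.uIoo_of_le (by norm_num)] at hs
    simp only [A, B, if_pos hs.2, e]
  have c2 : Set.EqOn (fun s => 2 * Real.sqrt (c (2 * s - 1) ^ 2 + d (2 * s - 1) ^ 2))
      (fun s => Real.sqrt (A s ^ 2 + B s ^ 2)) (Set.uIoo (1/2) 1) := by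
    intro s hs
    rw [Set.uIoo_of_le (by norm_num)] at hs
    simp only [A, B, if_neg (not_lt.2 hs.1.le), e]
  have j1 := i1.congr_uIoo c1
  have j2 := i2.congr_uIoo c2
  refine ⟨ψ, A, B, K * 2 + J * 2, ?_, ?_, ?_, ?_, j1.trans j2, ?_⟩
  · refine LipschitzWith.of_dist_le_mul fun x y => ?_
    have t1 : dist (min (2 * x) 1) (min (2 * y) 1) ≤ 2 * dist x y := by
      rw [Real.dist_eq, Real.dist_eq]
      refine (abs_min_sub_min_le_max _ _ _ _).trans ?_
      rw [← mul_sub, abs_mul]; simp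
    have t2 : dist (max (2 * x - 1) 0) (max (2 * y - 1) 0) ≤ 2 * dist x y := by
      rw [Real.dist_eq, Real.dist_eq]
      refine (abs_max_sub_max_le_max _ _ _ _).trans ?_
      rw [sub_sub_sub_cancel_right, ← mul_sub, abs_mul]; simp
    simp only [ψ, dist_sub_right]
    refine (dist_add_add_le _ _ _ _).trans ?_
    have u1 := hK.dist_le_mul (min (2 * x) 1) (min (2 * y) 1)
    have u2 := hJ.dist_le_mul (max (2 * x - 1) 0) (max (2 * y - 1) 0)
    push_cast
    nlinarith [mul_le_mul_of_nonneg_left t1 K.coe_nonneg, mul_le_mul_of_nonneg_left t2 J.coe_nonneg]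
  · simp [ψ, h0, k0]
  · norm_num [ψ, h1, k1]
  · have z : ∀ x : ℝ, ∀ᵐ s ∂(volume : Measure ℝ), s ≠ x := fun x => by
      simp [ae_iff]
    filter_upwards [ae_affine hd 0, ae_affine kd 1, z (1/2)] with s hs ks hz hmem
    simp only [sub_zero] at hs
    rcases lt_or_gt_of_ne hz with hlt | hgt
    · have hh := hs ⟨by linarith [hmem.1], by linarith⟩
      have h2 : HasDerivAt (fun s : ℝ => 2 * s) 2 s := by
        simpa using (hasDerivAt_id s).const_mul 2
      have := HasDerivAt.scomp s hh h2
      have ev : ψ =ᶠ[nhds s] (γ ∘ fun s => 2 * s) := by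
        filter_upwards [Iio_mem_nhds hlt] with u hu
        have hu : u < 1/2 := hu
        simp [ψ, min_eq_left (show 2 * u ≤ 1 by linarith), max_eq_right (show 2 * u - 1 ≤ 0 by linarith), k0]
      have hv := ev.eq_of_nhds
      refine (this.congr_of_eventuallyEq ev).congr_deriv ?_
      rw [hv]
      simp only [A, B, if_pos hlt, Function.comp]
      ext <;> simp <;> ring
    · have hh := ks ⟨by linarith [hmem.1], by linarith [hmem.2]⟩
      have h2 : HasDerivAt (fun s : ℝ => 2 * s - 1) 2 s := by
        simpa using ((hasDerivAt_id s).const_mul 2).sub_const 1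
      have := HasDerivAt.scomp s hh h2
      have ev : ψ =ᶠ[nhds s] (δ ∘ fun s => 2 * s - 1) := by
        filter_upwards [Ioi_mem_nhds hgt] with u hu
        have hu : 1/2 < u := hu
        simp [ψ, min_eq_right (show 1 ≤ 2 * u by linarith), max_eq_left (show 0 ≤ 2 * u - 1 by linarith), h1]
      have hv := ev.eq_of_nhds
      refine (this.congr_of_eventuallyEq ev).congr_deriv ?_
      rw [hv]
      simp only [A, B, if_neg (not_lt.2 hgt.le), Function.comp]
      ext <;> simp <;> ring
  · rw [← intervalIntegral.integral_add_adjacent_intervals j1 j2,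
      ← intervalIntegral.integral_congr_uIoo c1, ← intervalIntegral.integral_congr_uIoo c2,
      intervalIntegral.integral_const_mul, intervalIntegral.integral_const_mul,
      intervalIntegral.integral_comp_mul_left (fun s => Real.sqrt (a s ^ 2 + b s ^ 2)) two_ne_zero,
      intervalIntegral.integral_comp_mul_sub (fun s => Real.sqrt (c s ^ 2 + d s ^ 2)) two_ne_zero,
      hL, hM]
    norm_num
    ring

lemma lip_le {g h : ℝ → ℝ} {K : NNReal} (hg : LipschitzWith K g) {u : ℝ} (hu : 0 ≤ u)
    (hd : ∀ᵐ s ∂(volume : Measure ℝ), s ∈ Set.Icc 0 u → ∃ v, HasDerivAt g v s ∧ v ≤ h s)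
    (hi : IntervalIntegrable h volume 0 u) : g u - g 0 ≤ ∫ s in (0:ℝ)..u, h s := by
  have ac : AbsolutelyContinuousOnInterval g 0 u :=
    (hg.lipschitzOnWith (s := Set.uIcc 0 u)).absolutelyContinuousOnInterval
  rw [← ac.integral_deriv_eq_sub]
  refine intervalIntegral.integral_mono_ae_restrict hu ac.intervalIntegrable_deriv hi ?_
  refine (ae_restrict_iff' measurableSet_Icc).2 ?_
  filter_upwards [hd] with s hs hm
  obtain ⟨v, hv, hle⟩ := hs hm
  rw [hv.deriv]; exact hle

lemma cs2 (a b c d : ℝ) :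
    a * c + b * d ≤ Real.sqrt (a ^ 2 + b ^ 2) * Real.sqrt (c ^ 2 + d ^ 2) := by
  rw [← Real.sqrt_mul (by positivity)]
  apply Real.le_sqrt_of_sq_le
  nlinarith [sq_nonneg (a * d - b * c)]

lemma le_of_sq_le_mul {R L : ℝ} (hR : 0 ≤ R) (hL : 0 ≤ L) (h : R ^ 2 ≤ R * L) : R ≤ L := by
  rcases hR.eq_or_lt with h0 | h0
  · rw [← h0]; exact hL
  · nlinarith

lemma curve_z {γ : ℝ → H} {a b : ℝ → ℝ} {K : NNReal} (hK : LipschitzWith K γ)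
    (hd : ∀ᵐ s ∂(volume : Measure ℝ), s ∈ Set.Icc (0:ℝ) 1 →
      HasDerivAt γ (a s, b s, 2 * (γ s).2.1 * a s - 2 * (γ s).1 * b s) s)
    (hi : IntervalIntegrable (fun s => Real.sqrt (a s ^ 2 + b s ^ 2)) volume 0 1)
    {u : ℝ} (hu : u ∈ Set.Icc (0:ℝ) 1) :
    Real.sqrt (((γ u).1 - (γ 0).1) ^ 2 + ((γ u).2.1 - (γ 0).2.1) ^ 2) ≤
      ∫ s in (0:ℝ)..1, Real.sqrt (a s ^ 2 + b s ^ 2) := by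
  set A := (γ u).1 - (γ 0).1 with hA
  set B := (γ u).2.1 - (γ 0).2.1 with hB
  have hsub : Set.uIcc 0 u ⊆ Set.uIcc (0:ℝ) 1 := by
    rw [Set.uIcc_of_le hu.1, Set.uIcc_of_le zero_le_one]
    exact Set.Icc_subset_Icc_right hu.2
  have hi' := hi.mono_set hsub
  let ℓ : H →L[ℝ] ℝ := A • ContinuousLinearMap.fst ℝ ℝ (ℝ × ℝ) +
    B • ((ContinuousLinearMap.fst ℝ ℝ ℝ).comp (ContinuousLinearMap.snd ℝ ℝ (ℝ × ℝ)))
  have hl : ∀ p, ℓ p = A * p.1 + B * p.2.1 := by intro p; simp [ℓ]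
  have := lip_le (ℓ.lipschitz.comp hK) hu.1
    (h := fun s => Real.sqrt (A ^ 2 + B ^ 2) * Real.sqrt (a s ^ 2 + b s ^ 2)) (by
      filter_upwards [hd] with s hs hm
      refine ⟨_, ℓ.hasFDerivAt.comp_hasDerivAt s (hs ⟨hm.1, hm.2.trans hu.2⟩), ?_⟩
      rw [hl]; exact cs2 _ _ _ _) (hi'.const_mul _)
  rw [intervalIntegral.integral_const_mul] at this
  simp only [Function.comp, hl] at this
  have mono : ∫ s in (0:ℝ)..u, Real.sqrt (a s ^ 2 + b s ^ 2) ≤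
      ∫ s in (0:ℝ)..1, Real.sqrt (a s ^ 2 + b s ^ 2) :=
    intervalIntegral.integral_mono_interval le_rfl hu.1 hu.2
      (Filter.Eventually.of_forall fun s => Real.sqrt_nonneg _) hi
  refine le_of_sq_le_mul (Real.sqrt_nonneg _)
    (intervalIntegral.integral_nonneg zero_le_one (fun u _ => Real.sqrt_nonneg _)) ?_
  refine le_trans ?_ (mul_le_mul_of_nonneg_left mono (Real.sqrt_nonneg _))
  refine le_trans (le_of_eq ?_) this
  rw [Real.sq_sqrt (by positivity)]
  rw [hA, hB]; ring

lemma Reach.z_le {P Q : H} {L : ℝ} (h : Reach P Q L) :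
    Real.sqrt ((Q.1 - P.1) ^ 2 + (Q.2.1 - P.2.1) ^ 2) ≤ L := by
  obtain ⟨γ, a, b, K, hK, rfl, rfl, hd, hi, rfl⟩ := h
  exact curve_z hK hd hi ⟨zero_le_one, le_rfl⟩

lemma Reach.t_le {Q : H} {L : ℝ} (h : Reach HO Q L) : |Q.2.2| ≤ 2 * L ^ 2 := by
  have hL0 := h.nonneg
  obtain ⟨γ, a, b, K, hK, h0, rfl, hd, hi, hL⟩ := h
  have hz : ∀ s ∈ Set.Icc (0:ℝ) 1, Real.sqrt ((γ s).2.1 ^ 2 + (γ s).1 ^ 2) ≤ L := by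
    intro s hs
    have := curve_z hK hd hi hs
    rw [h0, ← hL] at this
    rw [add_comm]
    simpa [HO] using this
  have main : ∀ σ : ℝ, σ ^ 2 = 1 → σ * (γ 1).2.2 ≤ 2 * L ^ 2 := by
    intro σ hσ
    let ℓ : H →L[ℝ] ℝ := σ • ((ContinuousLinearMap.snd ℝ ℝ ℝ).comp
      (ContinuousLinearMap.snd ℝ ℝ (ℝ × ℝ)))
    have hl : ∀ p, ℓ p = σ * p.2.2 := by intro p; simp [ℓ]
    have := lip_le (ℓ.lipschitz.comp hK) zero_le_one
      (h := fun s => (2 * L) * Real.sqrt (a s ^ 2 + b s ^ 2)) (by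
        filter_upwards [hd] with s hs hm
        refine ⟨_, ℓ.hasFDerivAt.comp_hasDerivAt s (hs hm), ?_⟩
        rw [hl]
        have h1 := cs2 (γ s).2.1 (γ s).1 (σ * a s) (-(σ * b s))
        have h2 : (σ * a s) ^ 2 + (-(σ * b s)) ^ 2 = a s ^ 2 + b s ^ 2 := by
          linear_combination (a s ^ 2 + b s ^ 2) * hσ
        rw [h2] at h1
        have h3 := mul_le_mul_of_nonneg_right (hz s hm) (Real.sqrt_nonneg (a s ^ 2 + b s ^ 2))
        simp only
        linarith) (hi.const_mul _)
    rw [intervalIntegral.integral_const_mul, ← hL] at this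
    simp only [Function.comp, hl, h0] at this
    simp only [HO] at this
    linarith
  rw [abs_le]
  constructor
  · linarith [main (-1) (by norm_num)]
  · linarith [main 1 (by norm_num)]

/-- distance to the origin -/
def N0 (p : H) : ℝ := dH HO p

lemma Hmul_O (g : H) : Hmul g HO = g := by
  ext <;> simp [Hmul, HO]

lemma Reach.mul {p q : H} {L M : ℝ} (h : Reach HO p L) (h' : Reach HO q M) :
    Reach HO (Hmul p q) (L + M) := by
  have := h'.lmul p
  rw [Hmul_O] at this
  exact h.trans this

lemma reach_vert (t : ℝ) : Reach HO (0, 0, t) (2 * Real.sqrt |t|) := by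
  set r := Real.sqrt |t| / 2 with hr
  have r0 : 0 ≤ r := by positivity
  have r2 : 4 * r ^ 2 = |t| := by
    rw [hr, div_pow, Real.sq_sqrt (abs_nonneg t)]; ring
  obtain ⟨σ, hσ, hs⟩ : ∃ σ : ℝ, σ ^ 2 = 1 ∧ -4 * σ * r ^ 2 = t := by
    rcases abs_cases t with h | h
    · exact ⟨-1, by norm_num, by linarith⟩
    · exact ⟨1, by norm_num, by linarith⟩
  have s1 : ∀ τ : ℝ, τ ^ 2 = 1 → Reach HO (τ * r, 0, 0) r := by
    intro τ hτ
    have := Reach.seg (τ * r) 0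
    rwa [show (τ * r) ^ 2 + 0 ^ 2 = r ^ 2 by linear_combination r ^ 2 * hτ, Real.sqrt_sq r0] at this
  have s2 : ∀ τ : ℝ, τ ^ 2 = 1 → Reach HO (0, τ * r, 0) r := by
    intro τ hτ
    have := Reach.seg 0 (τ * r)
    rwa [show 0 ^ 2 + (τ * r) ^ 2 = r ^ 2 by linear_combination r ^ 2 * hτ, Real.sqrt_sq r0] at this
  have := (((s1 σ hσ).mul (s2 1 (by norm_num))).mul
    (s1 (-σ) (by linarith [neg_sq σ]))).mul (s2 (-1) (by norm_num))
  convert this using 1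
  · ext
    · simp [Hmul]
    · simp [Hmul]
    · simp [Hmul]; rw [← hs]; ring
  · rw [hr]; ring

lemma reach_all (p : H) : Reach HO p (Real.sqrt (p.1 ^ 2 + p.2.1 ^ 2) + 2 * Real.sqrt |p.2.2|) := by
  have := (Reach.seg p.1 p.2.1).mul (reach_vert p.2.2)
  convert this using 1
  ext <;> simp [Hmul]

lemma Hmul_inv (p q : H) : Hmul p (Hmul (Hinv p) q) = q := by
  ext <;> simp [Hmul, Hinv]
  ring

lemma Hinv_self (p : H) : Hmul (Hinv p) p = HO := by
  ext <;> simp [Hmul, Hinv, HO]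

lemma reach_iff (p q : H) (L : ℝ) : Reach p q L ↔ Reach HO (Hmul (Hinv p) q) L := by
  constructor
  · intro h
    have := h.lmul (Hinv p)
    rwa [Hinv_self] at this
  · intro h
    have := h.lmul p
    rwa [Hmul_O, Hmul_inv] at this

lemma dH_eq_N0 (p q : H) : dH p q = N0 (Hmul (Hinv p) q) := by
  simp only [N0, dH_eq, reach_iff p q]

lemma N0_le {p : H} {L : ℝ} (h : Reach HO p L) : N0 p ≤ L := h.dH_le

lemma le_N0 {p : H} {x : ℝ} (h : ∀ L, Reach HO p L → x ≤ L) : x ≤ N0 p :=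
  le_csInf ⟨_, reach_all p⟩ h

lemma N0_nonneg (p : H) : 0 ≤ N0 p := le_N0 fun _ h => h.nonneg

lemma N0_mul (p q : H) : N0 (Hmul p q) ≤ N0 p + N0 q := by
  have : N0 (Hmul p q) - N0 q ≤ N0 p := le_N0 fun L hL => by
    have : N0 (Hmul p q) - L ≤ N0 q := le_N0 fun M hM => by
      linarith [N0_le (hL.mul hM)]
    linarith
  linarith

lemma N0_dil {r : ℝ} (hr : 0 < r) (p : H) : N0 (dilLin r p) ≤ r * N0 p := by
  have : N0 (dilLin r p) / r ≤ N0 p := le_N0 fun L hL => by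
    have h := hL.dil hr.le
    rw [show dilLin r HO = HO by simp [HO, dilLin]] at h
    rw [div_le_iff₀ hr, mul_comm]
    exact N0_le h
  rwa [div_le_iff₀ hr, mul_comm] at this

lemma N0_z (p : H) : Real.sqrt (p.1 ^ 2 + p.2.1 ^ 2) ≤ N0 p := le_N0 fun L hL => by
  simpa [HO] using hL.z_le

lemma N0_t (p : H) : |p.2.2| ≤ 2 * N0 p ^ 2 := by
  have : Real.sqrt (|p.2.2| / 2) ≤ N0 p := le_N0 fun L hL => by
    rw [Real.sqrt_le_left hL.nonneg]
    linarith [hL.t_le]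
  rw [Real.sqrt_le_left (N0_nonneg p)] at this
  linarith

lemma N0_seg (x y : ℝ) : N0 (x, y, 0) ≤ Real.sqrt (x ^ 2 + y ^ 2) := N0_le (Reach.seg x y)

lemma N0_shift (x y t τ D : ℝ) (hD : N0 (x, y, t) = D) (hD0 : 0 < D) (hτ : |τ| ≤ D ^ 2 / 8) :
    N0 (x, y, t + τ) ≤ D + 16 * (|τ| / D) := by
  set r := Real.sqrt (x ^ 2 + y ^ 2) with hr
  have r0 : 0 ≤ r := Real.sqrt_nonneg _
  have r2 : r ^ 2 = x ^ 2 + y ^ 2 := Real.sq_sqrt (by positivity)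
  rcases le_or_gt (D / 4) r with hc | hc
  · have rp : 0 < r := by linarith
    set κ := τ / (4 * r ^ 2) with hκ
    have e1 : ∀ σ : ℝ, σ ^ 2 = 1 → N0 (σ * (-κ * y), σ * (κ * x), 0) ≤ |τ| / D := by
      intro σ hσ
      refine (N0_seg _ _).trans ?_
      rw [show (σ * (-κ * y)) ^ 2 + (σ * (κ * x)) ^ 2 = (|κ| * r) ^ 2 by
        rw [mul_pow |κ|, sq_abs, r2]; linear_combination κ ^ 2 * (x ^ 2 + y ^ 2) * hσ]
      rw [Real.sqrt_sq (by positivity), hκ, abs_div, abs_of_pos (show 0 < 4 * r ^ 2 by positivity)]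
      rw [show |τ| / (4 * r ^ 2) * r = |τ| / (4 * r) by field_simp]
      exact div_le_div_of_nonneg_left (abs_nonneg _) hD0 (by linarith)
    have m1 := N0_mul (Hmul (1 * (-κ * y), 1 * (κ * x), 0) (x, y, t))
      (-1 * (-κ * y), -1 * (κ * x), 0)
    have m2 := N0_mul (1 * (-κ * y), 1 * (κ * x), 0) (x, y, t)
    have e2 : Hmul (Hmul (1 * (-κ * y), 1 * (κ * x), 0) (x, y, t))
      (-1 * (-κ * y), -1 * (κ * x), 0) = (x, y, t + τ) := by
      have : 4 * κ * (x ^ 2 + y ^ 2) = τ := by rw [← r2, hκ]; field_simp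
      ext
      · simp [Hmul]
      · simp [Hmul]
      · simp [Hmul]; rw [← this]; ring
    rw [e2] at m1
    have := e1 1 (by norm_num)
    have := e1 (-1) (by norm_num)
    have : 0 ≤ |τ| / D := by positivity
    linarith
  · have h1 := N0_le (reach_all (x, y, t))
    simp only at h1
    rw [← hr, hD] at h1
    have ht : D ^ 2 / 8 < |t| := by
      have h2 : 3 * D / 8 ≤ Real.sqrt |t| := by linarith
      have h3 := Real.sq_sqrt (abs_nonneg t)
      nlinarith
    have tp : 0 < |t| := lt_of_le_of_lt (by positivity) ht
    have t0 : t ≠ 0 := abs_pos.1 tp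
    set q := τ / t with hq
    have qa : |q| ≤ 8 * (|τ| / D ^ 2) := by
      rw [hq, abs_div, div_le_iff₀ tp]
      have : 0 ≤ |τ| / D ^ 2 := by positivity
      have e : |τ| = |τ| / D ^ 2 * D ^ 2 := by field_simp
      nlinarith
    have q1 : |q| < 1 := by
      rw [hq, abs_div, div_lt_one tp]; linarith
    set s := Real.sqrt (1 + q) with hs
    have q2 := abs_lt.1 q1
    have sp : 0 < s := Real.sqrt_pos.2 (by linarith)
    have s2 : s ^ 2 = 1 + q := Real.sq_sqrt (by linarith)
    have s3 : |s - 1| ≤ |q| := by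
      have : q = (s - 1) * (s + 1) := by linear_combination -s2
      rw [this, abs_mul, abs_of_pos (show 0 < s + 1 by linarith)]
      nlinarith [abs_nonneg (s - 1)]
    have d1 := N0_dil sp (x, y, t)
    rw [hD] at d1
    have m := N0_mul (dilLin s (x, y, t)) (-(s - 1) * x, -(s - 1) * y, 0)
    have e2 : Hmul (dilLin s (x, y, t)) (-(s - 1) * x, -(s - 1) * y, 0) = (x, y, t + τ) := by
      have : t * q = τ := by rw [hq]; field_simp
      ext
      · simp [Hmul, dilLin]; ring
      · simp [Hmul, dilLin]; ring
      · simp [Hmul, dilLin]; rw [s2, ← this]; ring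
    rw [e2] at m
    have n := N0_seg (-(s - 1) * x) (-(s - 1) * y)
    rw [show (-(s - 1) * x) ^ 2 + (-(s - 1) * y) ^ 2 = (|s - 1| * r) ^ 2 by
      rw [mul_pow |s - 1|, sq_abs, r2]; ring, Real.sqrt_sq (by positivity)] at n
    have f1 : |s - 1| * r ≤ |s - 1| * D :=
      mul_le_mul_of_nonneg_left (by linarith) (abs_nonneg _)
    have f2 : s * D ≤ D + |s - 1| * D := by
      nlinarith [le_abs_self (s - 1)]
    have f3 : |s - 1| * D ≤ 8 * (|τ| / D) := by
      calc |s - 1| * D ≤ 8 * (|τ| / D ^ 2) * D :=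
            mul_le_mul_of_nonneg_right (s3.trans qa) hD0.le
        _ = _ := by field_simp
    linarith

lemma dH_z (p q : H) : Real.sqrt ((q.1 - p.1) ^ 2 + (q.2.1 - p.2.1) ^ 2) ≤ dH p q := by
  rw [dH_eq_N0]
  have := N0_z (Hmul (Hinv p) q)
  refine le_trans (le_of_eq ?_) this
  simp only [Hmul, Hinv]
  congr 1; ring

lemma ftc {g h : ℝ → ℝ} {K : ℝ} (hK : 0 ≤ K) (hg : ∀ s s', |g s - g s'| ≤ K * |s - s'|)
    (hd : ∀ᵐ s ∂(volume : Measure ℝ), HasDerivAt g (h s) s) (α β : ℝ) :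
    ∫ s in α..β, h s = g β - g α := by
  have hl : LipschitzWith ⟨K, hK⟩ g := LipschitzWith.of_dist_le_mul fun x y => by
    rw [Real.dist_eq, Real.dist_eq]; exact hg x y
  have ac : AbsolutelyContinuousOnInterval g α β :=
    (hl.lipschitzOnWith (s := Set.uIcc α β)).absolutelyContinuousOnInterval
  rw [← ac.integral_deriv_eq_sub]
  apply intervalIntegral.integral_congr_ae
  filter_upwards [hd] with s hs _
  rw [hs.deriv]

set_option maxHeartbeats 1000000 in
/-- main lower estimate -/
lemma lower {ε : ℝ} (h0 : 0 < ε) (h1 : ε ≤ 1 / 256) {γ : ℝ → H} (hγ : IsQuasiGeodesic ε γ)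
    {α β : ℝ} (hab : α < β) :
    (1 - 300 * Real.sqrt ε) * (β - α) ≤
      Real.sqrt (((γ β).1 - (γ α).1) ^ 2 + ((γ β).2.1 - (γ α).2.1) ^ 2) := by
  set e := Real.sqrt ε with he
  have e0 : 0 < e := Real.sqrt_pos.2 h0
  have e2 : e ^ 2 = ε := Real.sq_sqrt h0.le
  set L := β - α with hL
  have L0 : 0 < L := by simp [hL, hab]
  set n := e⁻¹ with hn
  have n0 : 0 < n := by positivity
  have ne : n * e = 1 := by rw [hn]; field_simp
  have e1 : e ≤ 1 / 16 := by nlinarith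
  set η := β + n * L with hη
  set P := Hmul (Hinv (γ α)) (γ β) with hP
  set Q := Hmul (Hinv (γ β)) (γ η) with hQ
  have hPQ : Hmul (Hinv (γ α)) (γ η) = Hmul P Q := by
    ext <;> simp [hP, hQ, Hmul, Hinv]
    ring
  have a1 := (hγ α β).2
  have a2 := hγ β η
  have a3 := (hγ α η).1
  have l1 : |α - β| = L := by rw [abs_sub_comm, abs_of_pos (by linarith)]
  have l2 : |β - η| = n * L := by
    rw [abs_sub_comm, abs_of_pos (by rw [hη]; nlinarith [mul_pos n0 L0]), hη]; ring
  have l3 : |α - η| = (n + 1) * L := by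
    rw [abs_sub_comm, abs_of_pos (by rw [hη]; nlinarith [mul_pos n0 L0]), hη, hL]; ring
  rw [dH_eq_N0, l1, ← hP] at a1
  rw [dH_eq_N0, l2, ← hQ] at a2
  rw [dH_eq_N0, l3, hPQ] at a3
  have inv : 1 - ε ≤ (1 + ε)⁻¹ := by
    rw [le_inv_comm₀ (by linarith) (by linarith), inv_eq_one_div, le_div_iff₀ (by linarith)]
    nlinarith
  have nL := mul_pos n0 L0
  have b2 := (mul_le_mul_of_nonneg_right inv nL.le).trans a2.1
  have b3 := (mul_le_mul_of_nonneg_right inv (by positivity : 0 ≤ (n + 1) * L)).trans a3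
  have hPt : |P.2.2| ≤ 8 * L ^ 2 := by
    have h := N0_t P
    have h' : N0 P ≤ 2 * L := a1.trans (by nlinarith)
    have := N0_nonneg P
    nlinarith
  have D1 : n * L / 2 ≤ N0 Q := le_trans (by nlinarith) b2
  have D0 : 0 < N0 Q := lt_of_lt_of_le (by positivity) D1
  have n16 : 16 ≤ n := by
    by_contra hlt
    push Not at hlt
    nlinarith
  have D2 : (8 * L) ^ 2 ≤ N0 Q ^ 2 := by
    apply pow_le_pow_left₀ (by positivity)
    nlinarith
  have sh := N0_shift Q.1 Q.2.1 Q.2.2 P.2.2 (N0 Q) rfl D0 (by nlinarith)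
  have c1 : |P.2.2| / N0 Q ≤ 16 * L * e := by
    rw [div_le_iff₀ D0]
    have : 16 * L * e * (n * L / 2) ≤ 16 * L * e * N0 Q :=
      mul_le_mul_of_nonneg_left D1 (by positivity)
    have h8 : 16 * L * e * (n * L / 2) = 8 * L ^ 2 := by
      linear_combination (8 * L ^ 2) * ne
    linarith
  have eqn : Hmul P Q = Hmul (P.1, P.2.1, 0) (Q.1, Q.2.1, Q.2.2 + P.2.2) := by
    ext <;> simp [Hmul]
    ring
  have tri := N0_mul (P.1, P.2.1, 0) (Q.1, Q.2.1, Q.2.2 + P.2.2)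
  rw [← eqn] at tri
  have sg := N0_seg P.1 P.2.1
  have hz : P.1 ^ 2 + P.2.1 ^ 2 =
      ((γ β).1 - (γ α).1) ^ 2 + ((γ β).2.1 - (γ α).2.1) ^ 2 := by
    simp only [hP, Hmul, Hinv]; ring
  rw [hz] at sg
  have f1 : (1 - ε) * ((n + 1) * L) - (1 + ε) * (n * L) - 16 * (16 * L * e) ≤
      Real.sqrt (((γ β).1 - (γ α).1) ^ 2 + ((γ β).2.1 - (γ α).2.1) ^ 2) := by
    linarith [a2.2]
  refine le_trans ?_ f1
  have nε : n * ε = e := by rw [← e2]; linear_combination e * ne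
  have : (1 - ε) * ((n + 1) * L) - (1 + ε) * (n * L) - 16 * (16 * L * e) =
      L * (1 - ε - 2 * e - 256 * e) := by
    linear_combination (-2 * L) * nε
  rw [this]
  have h5 : 0 ≤ e * (1 - e) := mul_nonneg e0.le (by linarith)
  have h6 : ε ≤ e := by linarith [show e * (1 - e) = e - e ^ 2 by ring]
  rw [mul_comm]
  exact mul_le_mul_of_nonneg_left (by linarith) L0.le

/-- Theorem A, approximation of quasigeodesics.
There are absolute constants `ε₀ > 0` and `C > 0` such that for every
`(1+ε)`-quasigeodesic `γ : ℝ → ℍ` with `0 < ε ≤ ε₀`, whose horizontal speed is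
`γ̇_H = (a, b)`, and every nondegenerate bounded interval `I = [α, β]`,
`1 − C√ε ≤ |(1/|I|) ∫_I γ̇_H(s) ds| ≤ 1 + ε` (Euclidean norm of the average). -/
theorem statement0 :
    ∃ ε₀ > (0:ℝ), ∃ C > (0:ℝ),
      ∀ ε : ℝ, 0 < ε → ε ≤ ε₀ →
      ∀ γ : ℝ → H, IsQuasiGeodesic ε γ →
      ∀ a b : ℝ → ℝ, HasHorizSpeed γ a b →
        LocallyIntegrable a volume → LocallyIntegrable b volume →
      ∀ α β : ℝ, α < β →
        1 - C * Real.sqrt ε ≤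
            Real.sqrt (((β - α)⁻¹ * ∫ s in α..β, a s) ^ 2
              + ((β - α)⁻¹ * ∫ s in α..β, b s) ^ 2) ∧
        Real.sqrt (((β - α)⁻¹ * ∫ s in α..β, a s) ^ 2
              + ((β - α)⁻¹ * ∫ s in α..β, b s) ^ 2) ≤ 1 + ε := by
  refine ⟨1 / 256, by norm_num, 300, by norm_num, ?_⟩
  intro ε h0 h1 γ hγ a b hs _ _ α β hab
  have K0 : (0:ℝ) ≤ 1 + ε := by linarith
  have hz : ∀ s s', Real.sqrt (((γ s').1 - (γ s).1) ^ 2 + ((γ s').2.1 - (γ s).2.1) ^ 2) ≤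
      (1 + ε) * |s - s'| := fun s s' => (dH_z _ _).trans (hγ s s').2
  have ha : ∫ s in α..β, a s = (γ β).1 - (γ α).1 := by
    refine ftc (g := fun s => (γ s).1) K0 (fun s s' => ?_) ?_ α β
    · refine le_trans ?_ (hz s s')
      rw [abs_sub_comm]
      exact Real.abs_le_sqrt (by nlinarith [sq_nonneg ((γ s').2.1 - (γ s).2.1)])
    · filter_upwards [hs] with s h
      exact hd1 h
  have hb : ∫ s in α..β, b s = (γ β).2.1 - (γ α).2.1 := by
    refine ftc (g := fun s => (γ s).2.1) K0 (fun s s' => ?_) ?_ α β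
    · refine le_trans ?_ (hz s s')
      rw [abs_sub_comm]
      exact Real.abs_le_sqrt (by nlinarith [sq_nonneg ((γ s').1 - (γ s).1)])
    · filter_upwards [hs] with s h
      exact hd2 h
  have L0 : 0 < β - α := by linarith
  rw [ha, hb]
  have e : Real.sqrt (((β - α)⁻¹ * ((γ β).1 - (γ α).1)) ^ 2 +
      ((β - α)⁻¹ * ((γ β).2.1 - (γ α).2.1)) ^ 2) =
      Real.sqrt (((γ β).1 - (γ α).1) ^ 2 + ((γ β).2.1 - (γ α).2.1) ^ 2) / (β - α) := by
    rw [mul_pow, mul_pow, ← mul_add, Real.sqrt_mul (by positivity),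
      Real.sqrt_sq (by positivity)]
    ring
  rw [e, le_div_iff₀ L0, div_le_iff₀ L0]
  refine ⟨lower h0 h1 hγ hab, ?_⟩
  have := hz α β
  rwa [abs_sub_comm, abs_of_pos L0] at this
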